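/- Fix positive integers n, b, L, t, M and K. If K · 2^(2bn² · 2^(KM + L + bt(n−1))) < 2^(2^(nL)), then there exists a function f : ({0,1}^L)^n → {0,1} such that for every k with 1 ≤ k ≤ K, no k-alternation protocol with t rounds, bandwidth b, and label sizes M₁ = ⋯ = M_k = M Σ_k-computes f. -/

import Mathlib

/-- An `(n,b,L,t)`-protocol: each node `v` has a private input `x_v ∈ {0,1}^L`.
In each round `r` of the `t` rounds, node `v` sends a `b`-bit message to each
other node, computed from `x_v` and the messages `v` received in rounds before `r`;
after round `t`, node `v` outputs a bit computed from `x_v` and all messages it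
received. -/
structure Protocol (n b L t : ℕ) where
  msg : (v : Fin n) → (r : Fin t) → (Fin L → Bool) →
      ((r' : Fin t) → r' < r → {u : Fin n // u ≠ v} → Fin b → Bool) →
      {w : Fin n // w ≠ v} → Fin b → Bool
  out : (v : Fin n) → (Fin L → Bool) →
      (Fin t → {u : Fin n // u ≠ v} → Fin b → Bool) → Bool

/-- `P.recv x r v u` is the message that node `v` receives from node `u` in
round `r`, when the protocol `P` is executed on the input assignment `x`. -/
def Protocol.recv {n b L t : ℕ} (P : Protocol n b L t) (x : Fin n → Fin L → Bool)
    (r : Fin t) (v : Fin n) (u : {u : Fin n // u ≠ v}) : Fin b → Bool :=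
  P.msg u.1 r (x u.1) (fun r' hr' w => P.recv x r' u.1 w) ⟨v, Ne.symm u.2⟩
termination_by r.1
decreasing_by exact hr'

/-- The output bit of node `v` when `P` is executed on input assignment `x`. -/
def Protocol.output {n b L t : ℕ} (P : Protocol n b L t)
    (x : Fin n → Fin L → Bool) (v : Fin n) : Bool :=
  P.out v (x v) (fun r u => P.recv x r v u)

/-- `P` computes `f` if on every input every node outputs `f` of the input. -/
def Protocol.Computes {n b L t : ℕ} (P : Protocol n b L t)
    (f : (Fin n → Fin L → Bool) → Bool) : Prop :=
  ∀ x : Fin n → Fin L → Bool, ∀ v : Fin n, P.output x v = f x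

/-- `P` accepts the input assignment `x` if all nodes output `1`. -/
def Protocol.Accepts {n b L t : ℕ} (P : Protocol n b L t)
    (x : Fin n → Fin L → Bool) : Prop :=
  ∀ v : Fin n, P.output x v = true

/-- A nondeterministic `(n,b,M,L,t)`-protocol for `f` is an `(n,b,M+L,t)`-protocol
`P` such that for every input `x` we have `f x = 1` iff there are `M`-bit labels
`z_v` such that `P` accepts when each node `v` is given the concatenation `z_v x_v`. -/
def Protocol.IsNondetFor {n b L t M : ℕ} (P : Protocol n b (M + L) t)
    (f : (Fin n → Fin L → Bool) → Bool) : Prop :=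
  ∀ x : Fin n → Fin L → Bool,
    f x = true ↔
      ∃ z : Fin n → Fin M → Bool, P.Accepts (fun v => Fin.append (z v) (x v))

mutual
  /-- Alternating block of quantifiers `∃ z¹ ∀ z² ∃ z³ ⋯` (k quantifiers,
  starting with `∃`), where each `zⁱ` ranges over assignments of `M`-bit labels
  to the `n` nodes, applied to the predicate `Q` of the whole label tuple. -/
  def SigmaQuant (n M : ℕ) : (k : ℕ) → ((Fin k → Fin n → Fin M → Bool) → Prop) → Prop
    | 0, Q => Q (fun i => i.elim0)
    | k + 1, Q => ∃ z : Fin n → Fin M → Bool, PiQuant n M k (fun zs => Q (Fin.cons z zs))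
  /-- Alternating block of quantifiers `∀ z¹ ∃ z² ∀ z³ ⋯` (k quantifiers,
  starting with `∀`). -/
  def PiQuant (n M : ℕ) : (k : ℕ) → ((Fin k → Fin n → Fin M → Bool) → Prop) → Prop
    | 0, Q => Q (fun i => i.elim0)
    | k + 1, Q => ∀ z : Fin n → Fin M → Bool, SigmaQuant n M k (fun zs => Q (Fin.cons z zs))
end

/-- Flatten `k` labels of `M` bits each into a single `k·M`-bit string. -/
def flattenLabels {k M : ℕ} (g : Fin k → Fin M → Bool) : Fin (k * M) → Bool :=
  fun i => g (finProdFinEquiv.symm i).1 (finProdFinEquiv.symm i).2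

/-- A `k`-alternation protocol with `t` rounds, bandwidth `b` and label sizes
`M₁ = ⋯ = M_k = M` is an `(n,b,kM+L,t)`-protocol, where node `v` receives the
concatenation of its `k` labels and its input `x_v`.  It `Σ_k`-computes `f` if
for all inputs `x` we have `f x = 1` iff `∃z¹ ∀z² ∃z³ ⋯ Q z^k : P(x,z¹,…,z^k) = 1`,
the quantifiers alternating starting with the existential one. -/
def Protocol.SigmaKComputes {n b L t : ℕ} (k M : ℕ) (P : Protocol n b (k * M + L) t)
    (f : (Fin n → Fin L → Bool) → Bool) : Prop :=
  ∀ x : Fin n → Fin L → Bool,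
    f x = true ↔
      SigmaQuant n M k (fun z =>
        P.Accepts (fun v => Fin.append (flattenLabels (fun i => z i v)) (x v)))

/-- A protocol amounts to its message functions together with its output functions. The history
available in round `r` is encoded as a function on `{r' // r' < r}`. -/
def Protocol.equivProd (n b L t : ℕ) : Protocol n b L t ≃
    ((v : Fin n) → (r : Fin t) → (Fin L → Bool) →
      ({r' : Fin t // r' < r} → {u : Fin n // u ≠ v} → Fin b → Bool) →
      {w : Fin n // w ≠ v} → Fin b → Bool) ×
    ((v : Fin n) → (Fin L → Bool) →
      (Fin t → {u : Fin n // u ≠ v} → Fin b → Bool) → Bool) where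
  toFun P := (fun v r x h => P.msg v r x (fun r' hr' => h ⟨r', hr'⟩), P.out)
  invFun q := ⟨fun v r x h => q.1 v r x (fun r' => h r'.1 r'.2), q.2⟩
  left_inv _ := rfl
  right_inv _ := rfl

set_option synthInstance.maxHeartbeats 200000 in
set_option synthInstance.maxSize 2000 in
instance Protocol.instFinite (n b L t : ℕ) : Finite (Protocol n b L t) :=
  Finite.of_equiv _ (Protocol.equivProd n b L t).symm

theorem Protocol.card_eq (n b L t : ℕ) : Nat.card (Protocol n b L t) =
    2 ^ (n * (∑ r : Fin t, b * (n - 1) * 2 ^ (L + b * (n - 1) * r) +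
      2 ^ (L + b * (n - 1) * t))) := by
  have hne (v : Fin n) : Nat.card {u : Fin n // u ≠ v} = n - 1 := by
    rw [Nat.card_eq_fintype_card, Fintype.card_subtype_compl]
    simp
  have hlt (r : Fin t) : Nat.card {r' : Fin t // r' < r} = r := by
    change Nat.card (Set.Iio r) = r
    simp
  have hbool : Nat.card Bool = 2 := by simp
  rw [Nat.card_congr (Protocol.equivProd n b L t), Nat.card_prod]
  simp only [Nat.card_pi, ← Nat.card_eq_fintype_card, hne, hlt, hbool, Nat.card_fin,
    Finset.prod_const, Finset.card_univ, ← pow_mul, Finset.prod_pow_eq_pow_sum]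
  rw [← pow_add]
  congr 1
  rw [mul_add, mul_comm n (2 ^ _), mul_comm n (∑ _, _), Finset.sum_mul, Finset.sum_mul]
  congr 1
  · refine Finset.sum_congr rfl fun r _ => ?_
    rw [pow_add]
    ring
  · rw [pow_add, mul_comm (2 ^ L)]

theorem mul_sum_two_pow_le (a t : ℕ) : ∑ r : Fin t, a * 2 ^ (a * (r : ℕ)) ≤ a * 2 ^ (a * t) := by
  rcases Nat.eq_zero_or_pos a with rfl | ha
  · simp
  · rw [← Finset.mul_sum, Fin.sum_univ_eq_sum_range (fun r => 2 ^ (a * r))]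
    refine Nat.mul_le_mul_left _ ?_
    simp only [pow_mul]
    exact (Nat.geomSum_lt (m := 2 ^ a) (n := t) (Nat.le_self_pow ha.ne' 2) (by simp)).le

theorem Protocol.card_le (n b L t : ℕ) (hn : 0 < n) (hb : 0 < b) :
    Nat.card (Protocol n b L t) ≤ 2 ^ (2 * b * n ^ 2 * 2 ^ (L + b * t * (n - 1))) := by
  rw [Protocol.card_eq]
  refine Nat.pow_le_pow_right two_pos ?_
  have hsum := Nat.mul_le_mul_left (2 ^ L) (mul_sum_two_pow_le (b * (n - 1)) t)
  have hrw : ∑ r : Fin t, b * (n - 1) * 2 ^ (L + b * (n - 1) * r) =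
      2 ^ L * ∑ r : Fin t, b * (n - 1) * 2 ^ (b * (n - 1) * (r : ℕ)) := by
    rw [Finset.mul_sum]
    exact Finset.sum_congr rfl fun r _ => by rw [pow_add]; ring
  rw [hrw, show b * t * (n - 1) = b * (n - 1) * t by ring, pow_add]
  set D := 2 ^ (b * (n - 1) * t)
  have hcoef : b * (n - 1) + 1 ≤ 2 * b * n := by
    have : b * (n - 1) ≤ b * n := Nat.mul_le_mul_left _ (Nat.sub_le _ _)
    have : 0 < b * n := Nat.mul_pos hb hn
    linarith
  calc
    _ ≤ n * (2 ^ L * (b * (n - 1) * D) + 2 ^ L * D) := by gcongr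
    _ = n * ((b * (n - 1) + 1) * (2 ^ L * D)) := by ring
    _ ≤ n * (2 * b * n * (2 ^ L * D)) := by gcongr
    _ = 2 * b * n ^ 2 * (2 ^ L * D) := by ring

/-- A `k`-alternation protocol `Σ_k`-computes at most one function. -/
theorem Protocol.SigmaKComputes.unique {n b L t k M : ℕ} {P : Protocol n b (k * M + L) t}
    {f g : (Fin n → Fin L → Bool) → Bool} (hf : P.SigmaKComputes k M f)
    (hg : P.SigmaKComputes k M g) : f = g :=
  funext fun x => Bool.eq_iff_iff.mpr ((hf x).trans (hg x).symm)

theorem exists_function_outside_bounded_alternation_hierarchy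
    (n b L t M K : ℕ) (hn : 0 < n) (hb : 0 < b) (hL : 0 < L) (ht : 0 < t)
    (hM : 0 < M) (hK : 0 < K)
    (h : K * 2 ^ (2 * b * n ^ 2 * 2 ^ (K * M + L + b * t * (n - 1))) < 2 ^ 2 ^ (n * L)) :
    ∃ f : (Fin n → Fin L → Bool) → Bool,
      ∀ k : ℕ, 1 ≤ k → k ≤ K →
        ∀ P : Protocol n b (k * M + L) t, ¬ Protocol.SigmaKComputes k M P f := by
  by_contra! hall
  have hcode (f : (Fin n → Fin L → Bool) → Bool) :
      ∃ c : Σ k : Fin K, Protocol n b ((k + 1 : ℕ) * M + L) t,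
        Protocol.SigmaKComputes (c.1 + 1) M c.2 f := by
    obtain ⟨k, hk, hkK, P, hP⟩ := hall f
    obtain ⟨k, rfl⟩ := Nat.exists_eq_add_of_le' hk
    exact ⟨⟨⟨k, hkK⟩, P⟩, hP⟩
  choose c hc using hcode
  have hinj : Function.Injective c := fun f g hfg => by
    have hg := hc g
    rw [← hfg] at hg
    exact (hc f).unique hg
  have hcard := Nat.card_le_card_of_injective c hinj
  have hfun : Nat.card ((Fin n → Fin L → Bool) → Bool) = 2 ^ 2 ^ (n * L) := by
    simp [← pow_mul, mul_comm]
  rw [hfun, Nat.card_sigma] at hcard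
  refine absurd (hcard.trans ?_) h.not_ge
  calc
    _ ≤ ∑ _k : Fin K, 2 ^ (2 * b * n ^ 2 * 2 ^ (K * M + L + b * t * (n - 1))) := by
      refine Finset.sum_le_sum fun k _ => (Protocol.card_le _ _ _ _ hn hb).trans ?_
      have hk : (k : ℕ) + 1 ≤ K := k.2
      gcongr <;> norm_num
    _ = _ := by simp
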